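/- There exist constants C, c > 0 and N ∈ ℕ such that for all n ≥ N the following holds: if w₀, w₁, …, w_n are independent standard Gaussian random variables N(0,1), and f : {−1,1}^n → {−1,1} is the random linear threshold function f(x) = sign(w₀ + Σ_{i=1}^n w_i x_i), then with probability at least 1 − e^{−c n} over the choice of the weights, the Fourier-Entropy-Influence inequality H(f) ≤ C·Inf(f) holds. -/

import Mathlib

open Finset Real MeasureTheory ProbabilityTheory
open scoped Classical

/-- sign: maps z to 1 if z > 0 and to −1 if z ≤ 0. -/
noncomputable def sgn (z : ℝ) : ℝ := if 0 < z then 1 else -1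

/-- interpret a Bool as ±1. -/
def pm (b : Bool) : ℝ := if b then 1 else -1

/-- probability of an event under the uniform distribution on {−1,1}^n. -/
noncomputable def unifPr (n : ℕ) (E : (Fin n → Bool) → Prop) : ℝ :=
  ((Finset.univ : Finset (Fin n → Bool)).filter E).card / 2 ^ n

/-- expectation under the uniform distribution on {−1,1}^n. -/
noncomputable def unifExp (n : ℕ) (g : (Fin n → Bool) → ℝ) : ℝ :=
  (∑ x : Fin n → Bool, g x) / 2 ^ n

/-- flip the i-th coordinate. -/
def flipAt {n : ℕ} (i : Fin n) (x : Fin n → Bool) : Fin n → Bool :=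
  Function.update x i (!(x i))

/-- influence of coordinate i. -/
noncomputable def infl {n : ℕ} (f : (Fin n → Bool) → ℝ) (i : Fin n) : ℝ :=
  unifPr n (fun x => f x ≠ f (flipAt i x))

/-- total influence. -/
noncomputable def totalInfl {n : ℕ} (f : (Fin n → Bool) → ℝ) : ℝ :=
  ∑ i, infl f i

/-- Fourier coefficient f̂(S). -/
noncomputable def fCoeff {n : ℕ} (f : (Fin n → Bool) → ℝ) (S : Finset (Fin n)) : ℝ :=
  unifExp n (fun x => f x * ∏ i ∈ S, pm (x i))

/-- Fourier entropy with log base 2 (0 · log(1/0) is 0 by convention, which holds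
definitionally since `Real.log 0 = 0` in Mathlib). -/
noncomputable def fourierEntropy {n : ℕ} (f : (Fin n → Bool) → ℝ) : ℝ :=
  ∑ S : Finset (Fin n), (fCoeff f S) ^ 2 * Real.logb 2 (1 / (fCoeff f S) ^ 2)

/-- The linear threshold function with weights w₀, w₁, …, w_n. -/
noncomputable def ltf (n : ℕ) (w : Fin (n + 1) → ℝ) : (Fin n → Bool) → ℝ :=
  fun x => sgn (w 0 + ∑ i : Fin n, w i.succ * pm (x i))

/-- linear form -/
noncomputable def lin {n : ℕ} (w : Fin (n + 1) → ℝ) (x : Fin n → Bool) : ℝ :=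
  w 0 + ∑ i : Fin n, w i.succ * pm (x i)

/-- flip all coordinates in `A`. -/
noncomputable def flipS {n : ℕ} (A : Finset (Fin n)) (x : Fin n → Bool) : Fin n → Bool :=
  fun i => if i ∈ A then !(x i) else x i

lemma flipS_flipS {n : ℕ} (A : Finset (Fin n)) (x : Fin n → Bool) : flipS A (flipS A x) = x := by
  funext i
  by_cases h : i ∈ A <;> simp [flipS, h]

lemma sum_flipS {n : ℕ} (A : Finset (Fin n)) (g : (Fin n → Bool) → ℝ) :
    ∑ x, g (flipS A x) = ∑ x, g x :=
  Equiv.sum_comp (Function.Involutive.toPerm (flipS A) (flipS_flipS A)) g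

lemma pm_not (b : Bool) : pm (!b) = - pm b := by cases b <;> simp [pm]

lemma pm_sq (b : Bool) : pm b ^ 2 = 1 := by cases b <;> simp [pm]

lemma pm_abs (b : Bool) : |pm b| = 1 := by cases b <;> simp [pm]

lemma pm_flipS {n : ℕ} (A : Finset (Fin n)) (x : Fin n → Bool) (i : Fin n) :
    pm (flipS A x i) = (if i ∈ A then -1 else 1) * pm (x i) := by
  by_cases h : i ∈ A <;> simp [flipS, h, pm_not]

lemma flipAt_eq {n : ℕ} (i : Fin n) (x : Fin n → Bool) : flipAt i x = flipS {i} x := by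
  funext j
  by_cases h : j = i
  · subst h; simp [flipAt, flipS]
  · simp [flipAt, flipS, h]

lemma card_cube (n : ℕ) : ∑ _x : Fin n → Bool, (1 : ℝ) = 2 ^ n := by simp

/-- character -/
noncomputable def chi {n : ℕ} (S : Finset (Fin n)) (x : Fin n → Bool) : ℝ := ∏ i ∈ S, pm (x i)

lemma chi_dual {n : ℕ} (x y : Fin n → Bool) :
    ∑ S : Finset (Fin n), chi S x * chi S y = if x = y then 2 ^ n else 0 := by
  have h : ∑ S : Finset (Fin n), chi S x * chi S y = ∏ i : Fin n, (1 + pm (x i) * pm (y i)) := by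
    rw [Finset.prod_one_add]
    simp [chi, Finset.prod_mul_distrib]
  rw [h]
  split_ifs with hxy
  · subst hxy
    have : ∀ i, (1 + pm (x i) * pm (x i)) = 2 := by
      intro i; have := pm_sq (x i); nlinarith
    simp [this]
  · obtain ⟨i, hi⟩ := Function.ne_iff.mp hxy
    apply Finset.prod_eq_zero (Finset.mem_univ i)
    revert hi
    cases x i <;> cases y i <;> simp [pm]

lemma plancherel {n : ℕ} (f g : (Fin n → Bool) → ℝ) :
    ∑ S : Finset (Fin n), fCoeff f S * fCoeff g S = (∑ x, f x * g x) / 2 ^ n := by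
  have h1 : ∀ S : Finset (Fin n), fCoeff f S * fCoeff g S =
      (∑ x, ∑ y, f x * g y * (chi S x * chi S y)) / (2 ^ n * 2 ^ n) := by
    intro S
    unfold fCoeff unifExp
    rw [div_mul_div_comm, Finset.sum_mul_sum]
    congr 1
    refine Finset.sum_congr rfl fun x _ => Finset.sum_congr rfl fun y _ => ?_
    simp only [chi]; ring
  simp_rw [h1]
  rw [← Finset.sum_div, Finset.sum_comm]
  have h2 : ∀ x : Fin n → Bool, ∑ S : Finset (Fin n), ∑ y, f x * g y * (chi S x * chi S y)
      = f x * g x * 2 ^ n := by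
    intro x
    rw [Finset.sum_comm]
    simp_rw [← Finset.mul_sum, chi_dual]
    simp
  simp_rw [h2]
  rw [← Finset.sum_mul]
  have : (2 : ℝ) ^ n ≠ 0 := by positivity
  field_simp

lemma fCoeff_flip {n : ℕ} (f : (Fin n → Bool) → ℝ) (A S : Finset (Fin n)) :
    fCoeff (fun x => f (flipS A x)) S = (∏ i ∈ S, if i ∈ A then (-1 : ℝ) else 1) * fCoeff f S := by
  unfold fCoeff unifExp
  rw [← mul_div_assoc, Finset.mul_sum, ← sum_flipS A]
  congr 1
  refine Finset.sum_congr rfl fun x _ => ?_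
  simp_rw [pm_flipS, Finset.prod_mul_distrib, flipS_flipS]
  ring

lemma sgn_sq (z : ℝ) : sgn z * sgn z = 1 := by unfold sgn; split_ifs <;> norm_num

lemma ltf_sq {n : ℕ} (w : Fin (n + 1) → ℝ) (x : Fin n → Bool) : ltf n w x * ltf n w x = 1 :=
  sgn_sq _

/-- partial linear form -/
noncomputable def plin {n : ℕ} (w : Fin (n + 1) → ℝ) (A : Finset (Fin n)) (x : Fin n → Bool) : ℝ :=
  ∑ i ∈ A, w i.succ * pm (x i)

lemma lin_flip {n : ℕ} (w : Fin (n + 1) → ℝ) (A : Finset (Fin n)) (x : Fin n → Bool) :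
    lin w (flipS A x) = lin w x - 2 * plin w A x := by
  unfold lin plin
  have : ∑ i ∈ A, w i.succ * pm (x i) = ∑ i, if i ∈ A then w i.succ * pm (x i) else 0 := by
    simp
  rw [this, Finset.mul_sum, add_sub_assoc, ← Finset.sum_sub_distrib]
  congr 1
  refine Finset.sum_congr rfl fun i _ => ?_
  rw [pm_flipS]
  split_ifs <;> ring

lemma plin_flip_self {n : ℕ} (w : Fin (n + 1) → ℝ) (A : Finset (Fin n)) (x : Fin n → Bool) :
    plin w A (flipS A x) = - plin w A x := by
  unfold plin
  rw [← Finset.sum_neg_distrib]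
  refine Finset.sum_congr rfl fun i hi => ?_
  rw [pm_flipS]; simp [hi]

lemma plin_flip_disj {n : ℕ} (w : Fin (n + 1) → ℝ) (A B : Finset (Fin n)) (h : Disjoint A B)
    (x : Fin n → Bool) : plin w A (flipS B x) = plin w A x := by
  unfold plin
  refine Finset.sum_congr rfl fun i hi => ?_
  rw [pm_flipS]; simp [Finset.disjoint_left.mp h hi]

lemma ltf_flip_pt {n : ℕ} (w : Fin (n + 1) → ℝ) (A : Finset (Fin n)) (x : Fin n → Bool) :
    1 - ltf n w x * ltf n w (flipS A x) =
      (ltf n w x - ltf n w (flipS A x)) * Real.sign (plin w A x) := by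
  have h1 : ltf n w x = sgn (lin w x) := rfl
  have h2 : ltf n w (flipS A x) = sgn (lin w x - 2 * plin w A x) := by
    rw [← lin_flip]; rfl
  rw [h1, h2]
  unfold sgn
  split_ifs with h3 h4 h4
  · norm_num
  · rw [Real.sign_of_pos (by linarith)]; norm_num
  · rw [Real.sign_of_neg (by linarith)]; norm_num
  · norm_num

lemma ltf_flip_sum {n : ℕ} (w : Fin (n + 1) → ℝ) (A : Finset (Fin n)) :
    ∑ x, (1 - ltf n w x * ltf n w (flipS A x)) =
      2 * ∑ x, ltf n w x * Real.sign (plin w A x) := by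
  simp_rw [ltf_flip_pt, sub_mul]
  rw [Finset.sum_sub_distrib]
  have : ∑ x, ltf n w (flipS A x) * Real.sign (plin w A x) =
      ∑ x, - (ltf n w x * Real.sign (plin w A x)) := by
    rw [← sum_flipS A (fun x => - (ltf n w x * Real.sign (plin w A x)))]
    refine Finset.sum_congr rfl fun x _ => ?_
    rw [plin_flip_self, Real.sign_neg]; ring
  rw [this, Finset.sum_neg_distrib]; ring

lemma sign_sq_le (z : ℝ) : Real.sign z * Real.sign z ≤ 1 := by
  rcases Real.sign_apply_eq z with h | h | h <;> rw [h] <;> norm_num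

/-- Peres' argument for a family of disjoint blocks. -/
lemma peres_blocks {n : ℕ} (w : Fin (n + 1) → ℝ) (J : Finset ℕ) (A : ℕ → Finset (Fin n))
    (hA : ∀ j k, j ≠ k → Disjoint (A j) (A k)) :
    ∑ j ∈ J, ∑ x, (1 - ltf n w x * ltf n w (flipS (A j) x)) ≤
      2 * (2 ^ n * √(J.card : ℝ)) := by
  simp_rw [ltf_flip_sum]
  rw [← Finset.mul_sum, Finset.sum_comm]
  simp_rw [← Finset.mul_sum]
  set D : (Fin n → Bool) → ℝ := fun x => ∑ j ∈ J, Real.sign (plin w (A j) x) with hD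
  have hcs := Finset.sum_mul_sq_le_sq_mul_sq Finset.univ (ltf n w) D
  have h1 : ∑ x, ltf n w x ^ 2 = 2 ^ n := by
    rw [← card_cube]
    exact Finset.sum_congr rfl fun x _ => by rw [sq, ltf_sq]
  have h2 : ∑ x, D x ^ 2 ≤ J.card * 2 ^ n := by
    have e : ∀ x, D x ^ 2 = ∑ j ∈ J, ∑ k ∈ J,
        Real.sign (plin w (A j) x) * Real.sign (plin w (A k) x) := by
      intro x; rw [sq, hD]; simp only; rw [Finset.sum_mul_sum]
    simp_rw [e]
    rw [Finset.sum_comm, ← nsmul_eq_mul]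
    apply Finset.sum_le_card_nsmul
    intro j hj
    rw [Finset.sum_comm, Finset.sum_eq_single_of_mem j hj]
    · rw [← card_cube]
      exact Finset.sum_le_sum fun x _ => sign_sq_le _
    · intro k _ hkj
      have : ∑ x, Real.sign (plin w (A j) x) * Real.sign (plin w (A k) x) =
          ∑ x, - (Real.sign (plin w (A j) x) * Real.sign (plin w (A k) x)) := by
        rw [← sum_flipS (A k)]
        refine Finset.sum_congr rfl fun x _ => ?_
        rw [plin_flip_self, plin_flip_disj _ _ _ (hA j k hkj.symm), Real.sign_neg]; ring
      rw [Finset.sum_neg_distrib] at this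
      linarith
  have h3 : (∑ x, ltf n w x * D x) ≤ 2 ^ n * √(J.card : ℝ) := by
    refine (le_abs_self _).trans (abs_le_of_sq_le_sq ?_ ?_)
    · rw [mul_pow, Real.sq_sqrt (by positivity)]
      rw [h1] at hcs
      have : (0:ℝ) < 2 ^ n := by positivity
      nlinarith
    · positivity
  linarith

lemma parseval_flip {n : ℕ} (f : (Fin n → Bool) → ℝ) (hf : ∀ x, f x * f x = 1)
    (A : Finset (Fin n)) :
    ∑ x, (1 - f x * f (flipS A x)) =
      2 ^ n * ∑ S : Finset (Fin n), (fCoeff f S) ^ 2 *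
        (1 - ∏ i ∈ S, if i ∈ A then (-1 : ℝ) else 1) := by
  have h1 := plancherel f f
  have h2 := plancherel f (fun x => f (flipS A x))
  simp_rw [fCoeff_flip] at h2
  have e : ∑ S : Finset (Fin n), (fCoeff f S) ^ 2 *
        (1 - ∏ i ∈ S, if i ∈ A then (-1 : ℝ) else 1) = 
      (∑ S : Finset (Fin n), fCoeff f S * fCoeff f S) - 
      ∑ S : Finset (Fin n), fCoeff f S *
        ((∏ i ∈ S, if i ∈ A then (-1 : ℝ) else 1) * fCoeff f S) := by
    rw [← Finset.sum_sub_distrib]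
    exact Finset.sum_congr rfl fun S _ => by ring
  rw [e, h1, h2, Finset.sum_sub_distrib]
  simp_rw [hf]
  have : (2 : ℝ) ^ n ≠ 0 := by positivity
  field_simp

lemma avg_R {n : ℕ} (S : Finset (Fin n)) (p : Fin n → ℕ) (j : ℕ) :
    ∑ R : Finset (Fin n), (1 - ∏ i ∈ S, if i ∈ R.filter (fun i => p i = j) then (-1 : ℝ) else 1)
      = 2 ^ n * (if j ∈ S.image p then 1 else 0) := by
  rw [Finset.sum_sub_distrib]
  have h : ∑ R : Finset (Fin n), ∏ i ∈ S, (if i ∈ R.filter (fun i => p i = j) then (-1 : ℝ) else 1)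
      = ∏ i : Fin n, (1 + if i ∈ S ∧ p i = j then (-1 : ℝ) else 1) := by
    rw [Finset.prod_one_add]
    simp only [Finset.powerset_univ]
    refine Finset.sum_congr rfl fun R _ => ?_
    rw [Finset.prod_ite, Finset.prod_ite]
    simp only [Finset.prod_const_one, mul_one, Finset.prod_const]
    congr 2
    ext i
    simp; tauto
  rw [h]
  split_ifs with hj
  · obtain ⟨i, hi, hij⟩ := Finset.mem_image.mp hj
    rw [Finset.prod_eq_zero (Finset.mem_univ i)]
    · simp
    · simp [hi, hij]
  · have : ∀ i, ¬ (i ∈ S ∧ p i = j) := by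
      rintro i ⟨h1, h2⟩
      exact hj (Finset.mem_image.mpr ⟨i, h1, h2⟩)
    simp only [this, if_false]
    norm_num

/-- Spectral-sample block count bound. -/
lemma block_bound {n : ℕ} (w : Fin (n + 1) → ℝ) (J : Finset ℕ) (p : Fin n → ℕ)
    (hp : ∀ i, p i ∈ J) :
    ∑ S : Finset (Fin n), (fCoeff (ltf n w) S) ^ 2 * ((S.image p).card : ℝ) ≤
      2 * √(J.card : ℝ) := by
  have h1 : ∑ R : Finset (Fin n), ∑ j ∈ J, ∑ x, (1 - ltf n w x *
      ltf n w (flipS (R.filter (fun i => p i = j)) x)) ≤ 2 ^ n * (2 * (2 ^ n * √(J.card : ℝ))) := by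
    have : (2:ℝ) ^ n = (Finset.univ : Finset (Finset (Fin n))).card := by simp
    rw [this, ← nsmul_eq_mul, ← this]
    apply Finset.sum_le_card_nsmul
    intro R _
    apply peres_blocks
    intro j k hjk
    rw [Finset.disjoint_left]
    intro i hi hi'
    simp only [Finset.mem_filter] at hi hi'
    exact hjk (hi.2.symm.trans hi'.2)
  simp_rw [parseval_flip _ (ltf_sq w)] at h1
  have h2 : ∑ R : Finset (Fin n), ∑ j ∈ J, 2 ^ n * ∑ S : Finset (Fin n), (fCoeff (ltf n w) S) ^ 2 *
        (1 - ∏ i ∈ S, if i ∈ R.filter (fun i => p i = j) then (-1 : ℝ) else 1) =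
      2 ^ n * (2 ^ n * ∑ S : Finset (Fin n), (fCoeff (ltf n w) S) ^ 2 * ((S.image p).card : ℝ)) := by
    simp_rw [← Finset.mul_sum]
    congr 1
    rw [Finset.sum_comm]
    have : ∀ j ∈ J, ∑ R : Finset (Fin n), ∑ S : Finset (Fin n), (fCoeff (ltf n w) S) ^ 2 *
        (1 - ∏ i ∈ S, if i ∈ R.filter (fun i => p i = j) then (-1 : ℝ) else 1) =
        ∑ S : Finset (Fin n), (fCoeff (ltf n w) S) ^ 2 * (2 ^ n * (if j ∈ S.image p then 1 else 0)) := by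
      intro j _
      rw [Finset.sum_comm]
      simp_rw [← Finset.mul_sum, avg_R]
    rw [Finset.sum_congr rfl this, Finset.sum_comm, Finset.mul_sum]
    refine Finset.sum_congr rfl fun S _ => ?_
    rw [← Finset.mul_sum, ← Finset.mul_sum]
    have : ∑ j ∈ J, (if j ∈ S.image p then (1:ℝ) else 0) = (S.image p).card := by
      rw [Finset.sum_ite_mem]
      have : J ∩ S.image p = S.image p := by
        apply Finset.inter_eq_right.mpr
        intro j hj
        obtain ⟨i, _, rfl⟩ := Finset.mem_image.mp hj
        exact hp i
      rw [this]; simp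
    rw [this]; ring
  rw [h2] at h1
  have h3 : (0:ℝ) < 2 ^ n := by positivity
  have h4 := le_of_mul_le_mul_left h1 h3
  have : 2 ^ n * ∑ S : Finset (Fin n), (fCoeff (ltf n w) S) ^ 2 * ((S.image p).card : ℝ) ≤
      2 ^ n * (2 * √(J.card : ℝ)) := by linarith
  exact le_of_mul_le_mul_left this h3

/-- code length (up to a factor 2) of a subset of `range (2^L)`. -/
noncomputable def cost (L : ℕ) (S : Finset ℕ) : ℕ :=
  ∑ l ∈ Finset.range L, (S.image (fun i => i / 2 ^ (l + 1))).card

lemma cost_succ (L : ℕ) (S : Finset ℕ) :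
    cost (L + 1) S = cost L (S.image (fun i => i / 2)) + (S.image (fun i => i / 2)).card := by
  unfold cost
  rw [Finset.sum_range_succ']
  congr 1
  · refine Finset.sum_congr rfl fun l _ => ?_
    rw [Finset.image_image]
    have : ((fun i => i / 2 ^ (l + 1)) ∘ fun i => i / 2) = fun i => i / 2 ^ (l + 1 + 1) := by
      funext i
      simp only [Function.comp, Nat.div_div_eq_div_mul]
      rw [pow_succ' 2 (l + 1)]
    rw [this]

lemma fiber_card (P : Finset (Finset ℕ)) (T : Finset ℕ) :
    (P.filter (fun S => S.image (fun i => i / 2) = T)).card ≤ 4 ^ T.card := by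
  have h4 : 4 ^ T.card = (T.powerset ×ˢ T.powerset).card := by
    rw [Finset.card_product, Finset.card_powerset, ← mul_pow]; norm_num
  rw [h4]
  apply Finset.card_le_card_of_injOn
    (fun S => (T.filter (fun t => 2 * t ∈ S), T.filter (fun t => 2 * t + 1 ∈ S)))
  · intro S _
    rw [Finset.mem_coe, Finset.mem_product, Finset.mem_powerset, Finset.mem_powerset]
    exact ⟨Finset.filter_subset _ _, Finset.filter_subset _ _⟩
  · intro S hS S' hS' h
    have hS1 := (Finset.mem_filter.mp (Finset.mem_coe.mp hS)).2
    have hS2 := (Finset.mem_filter.mp (Finset.mem_coe.mp hS')).2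
    simp only [Prod.mk.injEq] at h
    obtain ⟨ha, hb⟩ := h
    have key : ∀ U V : Finset ℕ, U.image (fun i => i / 2) = T →
        T.filter (fun t => 2 * t ∈ U) = T.filter (fun t => 2 * t ∈ V) →
        T.filter (fun t => 2 * t + 1 ∈ U) = T.filter (fun t => 2 * t + 1 ∈ V) →
        U ⊆ V := by
      intro U V hU h0 h1 i hi
      have ht : i / 2 ∈ T := by
        rw [← hU]; exact Finset.mem_image_of_mem _ hi
      rcases Nat.mod_two_eq_zero_or_one i with hm | hm
      · have e : 2 * (i / 2) = i := by omega
        have : i / 2 ∈ T.filter (fun t => 2 * t ∈ U) := by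
          rw [Finset.mem_filter, e]; exact ⟨ht, hi⟩
        rw [h0, Finset.mem_filter, e] at this
        exact this.2
      · have e : 2 * (i / 2) + 1 = i := by omega
        have : i / 2 ∈ T.filter (fun t => 2 * t + 1 ∈ U) := by
          rw [Finset.mem_filter, e]; exact ⟨ht, hi⟩
        rw [h1, Finset.mem_filter, e] at this
        exact this.2
    exact Finset.Subset.antisymm (key S S' hS1 ha hb) (key S' S hS2 ha.symm hb.symm)

lemma kraft (L : ℕ) :
    ∑ S ∈ (Finset.range (2 ^ L)).powerset, (1 / 4 : ℝ) ^ cost L S ≤ 2 := by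
  induction L with
  | zero => simp [cost]
  | succ L ih =>
    have hm : ∀ S ∈ (Finset.range (2 ^ (L + 1))).powerset,
        S.image (fun i => i / 2) ∈ (Finset.range (2 ^ L)).powerset := by
      intro S hS
      rw [Finset.mem_powerset] at hS ⊢
      intro t ht
      obtain ⟨i, hi, rfl⟩ := Finset.mem_image.mp ht
      have := Finset.mem_range.mp (hS hi)
      rw [Finset.mem_range]
      rw [pow_succ] at this
      omega
    rw [← Finset.sum_fiberwise_of_maps_to hm]
    refine le_trans (Finset.sum_le_sum fun T _ => ?_) ih
    have : ∀ S ∈ (Finset.range (2 ^ (L + 1))).powerset.filter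
        (fun S => S.image (fun i => i / 2) = T),
        (1 / 4 : ℝ) ^ cost (L + 1) S = (1 / 4 : ℝ) ^ (cost L T + T.card) := by
      intro S hS
      rw [cost_succ, (Finset.mem_filter.mp hS).2]
    rw [Finset.sum_congr rfl this, Finset.sum_const, nsmul_eq_mul, pow_add (1 / 4 : ℝ)]
    have hc : (((Finset.range (2 ^ (L + 1))).powerset.filter
        (fun S => S.image (fun i => i / 2) = T)).card : ℝ) ≤ 4 ^ T.card := by
      exact_mod_cast fiber_card _ T
    have h1 : (4:ℝ) ^ T.card * (1 / 4 : ℝ) ^ T.card = 1 := by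
      rw [← mul_pow]; norm_num
    calc _ ≤ (4:ℝ) ^ T.card * ((1 / 4 : ℝ) ^ cost L T * (1 / 4 : ℝ) ^ T.card) :=
          mul_le_mul_of_nonneg_right hc (by positivity)
      _ = (1 / 4 : ℝ) ^ cost L T * ((4:ℝ) ^ T.card * (1 / 4 : ℝ) ^ T.card) := by ring
      _ = _ := by rw [h1, mul_one]

lemma kraft_fin (n L : ℕ) (h : n ≤ 2 ^ L) :
    ∑ S : Finset (Fin n), (1 / 4 : ℝ) ^ cost L (S.image Fin.val) ≤ 2 := by
  refine le_trans ?_ (kraft L)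
  have hinj : Set.InjOn (fun S : Finset (Fin n) => S.image Fin.val)
      (Finset.univ : Finset (Finset (Fin n))) :=
    (Finset.image_injective Fin.val_injective).injOn
  rw [← Finset.sum_image (f := fun T => (1 / 4 : ℝ) ^ cost L T) hinj]
  apply Finset.sum_le_sum_of_subset_of_nonneg
  · intro T hT
    obtain ⟨S, _, rfl⟩ := Finset.mem_image.mp hT
    rw [Finset.mem_powerset]
    intro t ht
    obtain ⟨i, _, rfl⟩ := Finset.mem_image.mp ht
    rw [Finset.mem_range]
    exact lt_of_lt_of_le i.2 h
  · intros; positivity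

lemma gibbs_pt (p : ℝ) (hp : 0 ≤ p) (c : ℕ) :
    p * Real.logb 2 (1 / p) ≤ 2 * (p * c) + ((1 / 4 : ℝ) ^ c - p) / Real.log 2 := by
  have hl : 0 < Real.log 2 := Real.log_pos (by norm_num)
  rcases hp.eq_or_lt with h | h
  · rw [← h]; simp; positivity
  · set q : ℝ := (1 / 4 : ℝ) ^ c with hq
    have hq0 : 0 < q := by positivity
    have hlq : Real.log q = - (2 * c * Real.log 2) := by
      rw [hq, Real.log_pow, show (1 / 4 : ℝ) = (2 ^ 2)⁻¹ by norm_num, Real.log_inv, Real.log_pow]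
      push_cast; ring
    have h1 := Real.log_le_sub_one_of_pos (div_pos hq0 h)
    rw [Real.log_div hq0.ne' h.ne', hlq] at h1
    rw [Real.logb, one_div, Real.log_inv, ← mul_div_assoc]
    rw [div_le_iff₀ hl, add_mul, div_mul_cancel₀ _ hl.ne']
    have h2 : p * (-(2 * c * Real.log 2) - Real.log p) ≤ p * (q / p - 1) := by gcongr
    have h3 : p * (q / p - 1) = q - p := by field_simp
    rw [h3] at h2
    nlinarith

lemma geom (L : ℕ) : ∑ k ∈ Finset.range L, √2 ^ k ≤ 3 * √2 ^ L := by
  induction L with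
  | zero => simp
  | succ L ih =>
    rw [Finset.sum_range_succ, pow_succ]
    have h : (4 / 3 : ℝ) ≤ √2 := Real.le_sqrt_of_sq_le (by norm_num)
    have : 0 < √2 ^ L := by positivity
    nlinarith

lemma parseval_ltf {n : ℕ} (w : Fin (n + 1) → ℝ) :
    ∑ S : Finset (Fin n), (fCoeff (ltf n w) S) ^ 2 = 1 := by
  simp_rw [sq]
  rw [plancherel]
  simp_rw [ltf_sq]
  rw [card_cube]
  exact div_self (by positivity)

lemma entropy_bound {n : ℕ} (hn : 1 ≤ n) (w : Fin (n + 1) → ℝ) :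
    fourierEntropy (ltf n w) ≤ 20 * √(n : ℝ) := by
  obtain ⟨L, hL1, hL2⟩ : ∃ L : ℕ, n ≤ 2 ^ L ∧ 2 ^ L ≤ 2 * n := by
    refine ⟨Nat.log 2 n + 1, (Nat.lt_pow_succ_log_self (by norm_num) n).le, ?_⟩
    have := Nat.pow_log_le_self 2 (show n ≠ 0 by omega)
    rw [pow_succ]; omega
  set p : Finset (Fin n) → ℝ := fun S => (fCoeff (ltf n w) S) ^ 2 with hp
  have hpsum : ∑ S, p S = 1 := parseval_ltf w
  have h1 : fourierEntropy (ltf n w) ≤ ∑ S : Finset (Fin n),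
      (2 * (p S * (cost L (S.image Fin.val) : ℕ)) +
        ((1 / 4 : ℝ) ^ cost L (S.image Fin.val) - p S) / Real.log 2) := by
    apply Finset.sum_le_sum
    intro S _
    exact gibbs_pt _ (sq_nonneg _) _
  rw [Finset.sum_add_distrib, ← Finset.sum_div, Finset.sum_sub_distrib, hpsum,
    ← Finset.mul_sum] at h1
  have h2 := kraft_fin n L hL1
  have hl : (1 / 2 : ℝ) < Real.log 2 := by have := Real.log_two_gt_d9; linarith
  have h3 : (∑ S : Finset (Fin n), (1 / 4 : ℝ) ^ cost L (S.image Fin.val) - 1) /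
      Real.log 2 ≤ 2 := by
    rw [div_le_iff₀ (by linarith)]; linarith
  have h4 : ∑ S : Finset (Fin n), p S * (cost L (S.image Fin.val) : ℕ) ≤
      2 * (3 * √2 ^ L) := by
    have e : ∀ S : Finset (Fin n), p S * (cost L (S.image Fin.val) : ℕ) =
        ∑ l ∈ Finset.range L, p S * ((S.image (fun i : Fin n => (i : ℕ) / 2 ^ (l + 1))).card : ℝ) := by
      intro S
      unfold cost
      push_cast
      rw [Finset.mul_sum]
      refine Finset.sum_congr rfl fun l _ => ?_
      rw [Finset.image_image]
      rfl
    simp_rw [e]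
    rw [Finset.sum_comm]
    calc _ ≤ ∑ l ∈ Finset.range L, 2 * √2 ^ (L - 1 - l) := by
          apply Finset.sum_le_sum
          intro l hl
          have hl := Finset.mem_range.mp hl
          have := block_bound w (Finset.range (2 ^ (L - 1 - l)))
            (fun i : Fin n => (i : ℕ) / 2 ^ (l + 1)) (by
              intro i
              rw [Finset.mem_range, Nat.div_lt_iff_lt_mul (by positivity), ← pow_add]
              have : L - 1 - l + (l + 1) = L := by omega
              rw [this]
              exact lt_of_lt_of_le i.2 hL1)
          refine this.trans (le_of_eq ?_)
          rw [Finset.card_range]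
          push_cast
          congr 1
          rw [Real.sqrt_eq_iff_mul_self_eq (by positivity) (by positivity), ← mul_pow]
          norm_num
      _ = 2 * ∑ k ∈ Finset.range L, √2 ^ k := by
          rw [← Finset.mul_sum, Finset.sum_range_reflect (fun k => √2 ^ k)]
      _ ≤ _ := by linarith [geom L]
  have h5 : √2 ^ L ≤ √2 * √n := by
    rw [← Real.sqrt_mul (by norm_num)]
    apply Real.le_sqrt_of_sq_le
    rw [← pow_mul, mul_comm, pow_mul, Real.sq_sqrt (by norm_num)]
    exact_mod_cast hL2
  have h6 : √2 ≤ 1.45 := by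
    rw [Real.sqrt_le_left (by norm_num)]; norm_num
  have h7 : 1 ≤ √(n:ℝ) := by
    rw [Real.one_le_sqrt]; exact_mod_cast hn
  nlinarith

/-- variance -/
noncomputable def vv {n : ℕ} (w : Fin (n + 1) → ℝ) : ℝ := ∑ i, w i ^ 2

lemma sum_odd {n : ℕ} (i : Fin n) (g : (Fin n → Bool) → ℝ)
    (hg : ∀ x, g (flipS {i} x) = g x) : ∑ x, g x * pm (x i) = 0 := by
  have : ∑ x, g x * pm (x i) = ∑ x, - (g x * pm (x i)) := by
    rw [← sum_flipS {i}]
    refine Finset.sum_congr rfl fun x _ => ?_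
    rw [hg, pm_flipS]; simp
  rw [Finset.sum_neg_distrib] at this
  linarith

lemma moments {n : ℕ} (w : Fin (n + 1) → ℝ) (T : Finset (Fin n)) :
    ∑ x, (w 0 + plin w T x) ^ 2 = 2 ^ n * (w 0 ^ 2 + ∑ i ∈ T, w i.succ ^ 2) ∧
    ∑ x, (w 0 + plin w T x) ^ 4 ≤ 2 ^ n * (3 * (w 0 ^ 2 + ∑ i ∈ T, w i.succ ^ 2) ^ 2) := by
  induction T using Finset.induction_on with
  | empty =>
    simp only [plin, Finset.sum_empty, add_zero, Finset.sum_const, Finset.card_univ,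
      Fintype.card_pi, Fintype.card_bool, Finset.prod_const, Fintype.card_fin, nsmul_eq_mul]
    push_cast
    refine ⟨rfl, ?_⟩
    have : 0 ≤ w 0 ^ 4 := by positivity
    have : (0:ℝ) < 2 ^ n := by positivity
    gcongr
    nlinarith
  | insert i T hi ih =>
    obtain ⟨ih2, ih4⟩ := ih
    set X : (Fin n → Bool) → ℝ := fun x => w 0 + plin w T x with hX
    set a := w i.succ with ha
    set m := w 0 ^ 2 + ∑ i ∈ T, w i.succ ^ 2 with hm
    have hXf : ∀ x, X (flipS {i} x) = X x := by
      intro x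
      simp only [hX]
      rw [plin_flip_disj _ _ _ (by simpa using hi)]
    have e : ∀ x, w 0 + plin w (insert i T) x = X x + a * pm (x i) := by
      intro x; simp only [hX, plin]; rw [Finset.sum_insert hi]; ring
    have em : w 0 ^ 2 + ∑ i ∈ insert i T, w i.succ ^ 2 = m + a ^ 2 := by
      rw [Finset.sum_insert hi]; ring
    rw [em]
    simp_rw [e]
    have o1 := sum_odd i (fun x => 2 * a * X x) (by intro x; simp only [hXf])
    have o2 := sum_odd i (fun x => 4 * a * X x ^ 3 + 4 * a ^ 3 * X x) (by intro x; simp only [hXf])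
    have hc := card_cube n
    constructor
    · have : ∀ x, (X x + a * pm (x i)) ^ 2 = X x ^ 2 + (2 * a * X x) * pm (x i) + a ^ 2 * 1 := by
        intro x
        have := pm_sq (x i)
        linear_combination a ^ 2 * this
      simp_rw [this]
      rw [Finset.sum_add_distrib, Finset.sum_add_distrib, o1, ← Finset.mul_sum, hc, ih2]
      ring
    · have : ∀ x, (X x + a * pm (x i)) ^ 4 = X x ^ 4 + (4 * a * X x ^ 3 + 4 * a ^ 3 * X x) * pm (x i)
          + 6 * a ^ 2 * X x ^ 2 + a ^ 4 * 1 := by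
        intro x
        have := pm_sq (x i)
        linear_combination (6 * a ^ 2 * X x ^ 2 + 4 * a ^ 3 * X x * pm (x i)
          + a ^ 4 * (pm (x i) ^ 2 + 1)) * this
      simp_rw [this]
      rw [Finset.sum_add_distrib, Finset.sum_add_distrib, Finset.sum_add_distrib, o2,
        ← Finset.mul_sum, ← Finset.mul_sum, hc, ih2]
      have : (0:ℝ) < 2 ^ n := by positivity
      have : 0 ≤ 2 ^ n * a ^ 4 := by positivity
      nlinarith

lemma lin_eq {n : ℕ} (w : Fin (n + 1) → ℝ) (x : Fin n → Bool) :
    lin w x = w 0 + plin w Finset.univ x := rfl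

lemma vv_eq {n : ℕ} (w : Fin (n + 1) → ℝ) :
    w 0 ^ 2 + ∑ i ∈ (Finset.univ : Finset (Fin n)), w i.succ ^ 2 = vv w := by
  unfold vv; rw [Fin.sum_univ_succ]

lemma abs_lower (t s : ℝ) (hs : 0 < s) : t ^ 2 / s - 4 / 27 * (t ^ 4 / s ^ 3) ≤ |t| := by
  have h : ∀ u : ℝ, 0 ≤ u → u ^ 2 - 4 / 27 * u ^ 4 ≤ u := by
    intro u hu
    have : 0 ≤ u * ((2 * u / 3 - 1) ^ 2 * (u / 3 + 1)) := by positivity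
    nlinarith
  have h1 := h (|t| / s) (by positivity)
  have h2 : t ^ 2 / s - 4 / 27 * (t ^ 4 / s ^ 3) =
      s * ((|t| / s) ^ 2 - 4 / 27 * (|t| / s) ^ 4) := by
    have e4 : |t| ^ 4 = t ^ 4 := by rw [← abs_pow, abs_of_nonneg (by positivity)]
    rw [div_pow, div_pow, sq_abs, e4]
    field_simp
  rw [h2]
  calc _ ≤ s * (|t| / s) := by gcongr
    _ = |t| := by field_simp

lemma khinchine {n : ℕ} (w : Fin (n + 1) → ℝ) :
    2 ^ n * (√(vv w) / 2) ≤ ∑ x, |lin w x| := by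
  have h0 : 0 ≤ vv w := by unfold vv; positivity
  rcases h0.eq_or_lt with h | h
  · rw [← h]; simp; positivity
  · set s := √(vv w) with hs
    have hs0 : 0 < s := Real.sqrt_pos.mpr h
    have hss : s ^ 2 = vv w := Real.sq_sqrt h0
    obtain ⟨m2, m4⟩ := moments w Finset.univ
    simp_rw [← lin_eq] at m2 m4
    rw [vv_eq] at m2 m4
    have h1 : ∑ x, (lin w x ^ 2 / s - 4 / 27 * (lin w x ^ 4 / s ^ 3)) ≤ ∑ x, |lin w x| :=
      Finset.sum_le_sum fun x _ => abs_lower _ _ hs0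
    rw [Finset.sum_sub_distrib, ← Finset.mul_sum, ← Finset.sum_div, ← Finset.sum_div, m2] at h1
    have h2 : (∑ x, lin w x ^ 4) / s ^ 3 ≤ 2 ^ n * (3 * s) := by
      rw [div_le_iff₀ (by positivity)]
      rw [← hss] at m4
      calc _ ≤ _ := m4
        _ = _ := by ring
    have h3 : 2 ^ n * vv w / s = 2 ^ n * s := by rw [← hss]; field_simp
    rw [h3] at h1
    have : (0:ℝ) < 2 ^ n * s := by positivity
    linarith

lemma infl_eq {n : ℕ} (w : Fin (n + 1) → ℝ) (i : Fin n) :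
    2 * 2 ^ n * infl (ltf n w) i = ∑ x, (1 - ltf n w x * ltf n w (flipS {i} x)) := by
  unfold infl unifPr
  have h : ∀ x, (1 - ltf n w x * ltf n w (flipS {i} x)) =
      2 * (if ltf n w x ≠ ltf n w (flipAt i x) then 1 else 0) := by
    intro x
    rw [flipAt_eq]
    have a : ∀ x, ltf n w x = 1 ∨ ltf n w x = -1 := fun x => mul_self_eq_one_iff.mp (ltf_sq w x)
    rcases a x with h1 | h1 <;> rcases a (flipS {i} x) with h2 | h2 <;> rw [h1, h2] <;> norm_num
  simp_rw [h]
  rw [← Finset.mul_sum, Finset.sum_boole]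
  have : (2:ℝ) ^ n ≠ 0 := by positivity
  field_simp
  congr!

lemma coeff_le_infl {n : ℕ} (w : Fin (n + 1) → ℝ) (i : Fin n) :
    |∑ x, ltf n w x * pm (x i)| ≤ 2 ^ n * infl (ltf n w) i := by
  have h1 : 2 * ∑ x, ltf n w x * pm (x i) =
      ∑ x, (ltf n w x - ltf n w (flipS {i} x)) * pm (x i) := by
    simp_rw [sub_mul]
    rw [Finset.sum_sub_distrib]
    have : ∑ x, ltf n w (flipS {i} x) * pm (x i) = ∑ x, - (ltf n w x * pm (x i)) := by
      rw [← sum_flipS {i} (fun x => - (ltf n w x * pm (x i)))]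
      refine Finset.sum_congr rfl fun x _ => ?_
      rw [pm_flipS]; simp
    rw [this, Finset.sum_neg_distrib]; ring
  have h2 : |∑ x, (ltf n w x - ltf n w (flipS {i} x)) * pm (x i)| ≤ 
      ∑ x, (1 - ltf n w x * ltf n w (flipS {i} x)) := by
    refine (Finset.abs_sum_le_sum_abs _ _).trans (Finset.sum_le_sum fun x _ => ?_)
    rw [abs_mul, pm_abs, mul_one]
    have a : ∀ x, ltf n w x = 1 ∨ ltf n w x = -1 := fun x => mul_self_eq_one_iff.mp (ltf_sq w x)
    rcases a x with h1 | h1 <;> rcases a (flipS {i} x) with h2 | h2 <;> rw [h1, h2] <;> norm_num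
  rw [← h1, ← infl_eq, abs_mul, abs_two] at h2
  linarith

lemma ltf_l2 {n : ℕ} (w u : Fin (n + 1) → ℝ) :
    ∑ x, ltf n w x * lin u x ≤ 2 ^ n * √(vv u) := by
  have h0 : 0 ≤ vv u := by unfold vv; positivity
  have hcs := Finset.sum_mul_sq_le_sq_mul_sq Finset.univ (ltf n w) (lin u)
  have h1 : ∑ x, ltf n w x ^ 2 = 2 ^ n := by
    rw [← card_cube]
    exact Finset.sum_congr rfl fun x _ => by rw [sq, ltf_sq]
  have m2 := (moments u Finset.univ).1
  simp_rw [← lin_eq] at m2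
  rw [vv_eq] at m2
  rw [h1, m2] at hcs
  refine (le_abs_self _).trans (abs_le_of_sq_le_sq ?_ (by positivity))
  rw [mul_pow, Real.sq_sqrt h0]
  linarith

lemma ltf_l1 {n : ℕ} (w u : Fin (n + 1) → ℝ) (M : ℝ) (hu : ∀ i, |u i| ≤ M) :
    ∑ x, ltf n w x * lin u x ≤ 2 ^ n * (M * (1 + totalInfl (ltf n w))) := by
  have hM : 0 ≤ M := (abs_nonneg _).trans (hu 0)
  have e : ∑ x, ltf n w x * lin u x = u 0 * ∑ x, ltf n w x +
      ∑ i : Fin n, u i.succ * ∑ x, ltf n w x * pm (x i) := by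
    unfold lin
    simp_rw [mul_add, Finset.sum_add_distrib, Finset.mul_sum]
    congr 1
    · exact Finset.sum_congr rfl fun x _ => by ring
    · rw [Finset.sum_comm]
      exact Finset.sum_congr rfl fun i _ => Finset.sum_congr rfl fun x _ => by ring
  have b0 : |∑ x, ltf n w x| ≤ 2 ^ n := by
    refine (Finset.abs_sum_le_sum_abs _ _).trans ?_
    rw [← card_cube]
    refine Finset.sum_le_sum fun x _ => ?_
    rcases mul_self_eq_one_iff.mp (ltf_sq w x) with h | h <;> rw [h] <;> norm_num
  have mm : ∀ a b c : ℝ, |a| ≤ M → |b| ≤ c → a * b ≤ M * c := by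
    intro a b c ha hb
    calc a * b ≤ |a * b| := le_abs_self _
      _ = |a| * |b| := abs_mul _ _
      _ ≤ M * c := by gcongr
  rw [e]
  have t1 := mm _ _ _ (hu 0) b0
  have t2 : ∑ i : Fin n, u i.succ * ∑ x, ltf n w x * pm (x i) ≤
      ∑ i : Fin n, M * (2 ^ n * infl (ltf n w) i) :=
    Finset.sum_le_sum fun i _ => mm _ _ _ (hu _) (coeff_le_infl w i)
  rw [← Finset.mul_sum, ← Finset.mul_sum] at t2
  have : totalInfl (ltf n w) = ∑ i, infl (ltf n w) i := rfl
  rw [this]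
  linarith

/-- large part of a weight -/
noncomputable def big (t : ℝ) : ℝ := if 8 < |t| then t else 0

lemma infl_lower {n : ℕ} (w : Fin (n + 1) → ℝ) :
    √(vv w) / 2 ≤ 8 * (1 + totalInfl (ltf n w)) + √(vv (fun i => big (w i))) := by
  have h1 := khinchine w
  have h2 := ltf_l2 w (fun i => big (w i))
  have h3 := ltf_l1 w (fun i => w i - big (w i)) 8 (by
    intro i
    simp only [big]
    split_ifs with h
    · simp
    · simpa using h)
  have h4 : ∑ x, |lin w x| = ∑ x, ltf n w x * lin (fun i => w i - big (w i)) x +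
      ∑ x, ltf n w x * lin (fun i => big (w i)) x := by
    rw [← Finset.sum_add_distrib]
    refine Finset.sum_congr rfl fun x _ => ?_
    rw [← mul_add]
    have e : lin (fun i => w i - big (w i)) x + lin (fun i => big (w i)) x = lin w x := by
      simp only [lin, sub_mul, Finset.sum_sub_distrib]; ring
    rw [e]
    have : ltf n w x = sgn (lin w x) := rfl
    rw [this]
    unfold sgn
    split_ifs with h
    · rw [abs_of_pos h, one_mul]
    · rw [abs_of_nonpos (not_lt.mp h)]; ring
  have : (0:ℝ) < 2 ^ n := by positivity
  have h5 : 2 ^ n * (√(vv w) / 2) ≤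
      2 ^ n * (8 * (1 + totalInfl (ltf n w)) + √(vv (fun i => big (w i)))) := by linarith
  exact le_of_mul_le_mul_left h5 this

/-- good-event statistic -/
noncomputable def phi (t : ℝ) : ℝ := t ^ 2 / 16 - big t ^ 2

lemma good {n : ℕ} (hn : 20000 ≤ n) (w : Fin (n + 1) → ℝ)
    (h : (1 / 50 : ℝ) * (n + 1) ≤ ∑ i, phi (w i)) :
    fourierEntropy (ltf n w) ≤ 2560 * totalInfl (ltf n w) := by
  have e : ∑ i, phi (w i) = vv w / 16 - vv (fun i => big (w i)) := by
    unfold phi vv; rw [Finset.sum_sub_distrib, Finset.sum_div]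
  rw [e] at h
  have h0 : 0 ≤ vv (fun i => big (w i)) := by unfold vv; positivity
  have h1 : √(vv (fun i => big (w i))) ≤ √(vv w) / 4 := by
    rw [Real.sqrt_le_left (by positivity), div_pow, Real.sq_sqrt (by unfold vv; positivity)]
    have : (0:ℝ) ≤ n := by positivity
    linarith
  have h2 : √(n:ℝ) / 2 ≤ √(vv w) := by
    apply Real.le_sqrt_of_sq_le
    rw [div_pow, Real.sq_sqrt (by positivity)]
    have : (0:ℝ) ≤ n := by positivity
    linarith
  have h3 := infl_lower w
  have h4 := entropy_bound (by omega) w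
  have h5 : 128 ≤ √(n:ℝ) := by
    apply Real.le_sqrt_of_sq_le
    have : (20000:ℝ) ≤ n := by exact_mod_cast hn
    linarith
  linarith

lemma gauss_exp (s : ℝ) :
    ∫ t, Real.exp (s * t ^ 2) ∂(gaussianReal 0 1) = (√(2 * π))⁻¹ * √(π / (1 / 2 - s)) := by
  rw [integral_gaussianReal_eq_integral_smul (by norm_num), ← integral_gaussian,
    ← integral_const_mul]
  congr 1
  funext t
  simp only [gaussianPDFReal, smul_eq_mul, NNReal.coe_one, mul_one, sub_zero]
  rw [mul_assoc, ← Real.exp_add]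
  congr 2
  ring

lemma gauss_exp' (s r : ℝ) (hr : 0 < r) (h : r ^ 2 * (1 - 2 * s) = 1) :
    ∫ t, Real.exp (s * t ^ 2) ∂(gaussianReal 0 1) = r := by
  have h1 : 0 < 1 - 2 * s := by
    by_contra hh
    have := sq_nonneg r
    nlinarith
  rw [gauss_exp, ← Real.sqrt_inv, ← Real.sqrt_mul (by positivity)]
  rw [Real.sqrt_eq_iff_mul_self_eq (by
    have : 0 < 1 / 2 - s := by linarith
    positivity) hr.le]
  have := Real.pi_pos
  have h2 : (1 / 2 - s) ≠ 0 := by linarith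
  field_simp
  linarith

lemma gauss_int (s r : ℝ) (hr : 0 < r) (h : r ^ 2 * (1 - 2 * s) = 1) :
    Integrable (fun t => Real.exp (s * t ^ 2)) (gaussianReal 0 1) := by
  apply Integrable.of_integral_ne_zero
  rw [gauss_exp' s r hr h]
  exact hr.ne'

lemma measurable_phi : Measurable phi := by
  unfold phi big
  have : Measurable (fun t : ℝ => if 8 < |t| then t else 0) :=
    Measurable.ite (measurableSet_lt measurable_const (by fun_prop)) measurable_id measurable_const
  fun_prop

lemma exp_phi_le (t : ℝ) : Real.exp (-(1 / 4) * phi t) ≤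
    Real.exp (-(1 / 64) * t ^ 2) + Real.exp (-8) * Real.exp (3 / 8 * t ^ 2) := by
  unfold phi big
  split_ifs with h
  · rw [← Real.exp_add]
    have : 64 ≤ t ^ 2 := by
      rw [← sq_abs]; nlinarith
    have h1 : Real.exp (-(1 / 4) * (t ^ 2 / 16 - t ^ 2)) ≤ Real.exp (-8 + 3 / 8 * t ^ 2) := by
      apply Real.exp_le_exp.mpr; linarith
    have := Real.exp_pos (-(1 / 64) * t ^ 2)
    linarith
  · have h1 : Real.exp (-(1 / 4) * (t ^ 2 / 16 - 0 ^ 2)) = Real.exp (-(1 / 64) * t ^ 2) := by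
      congr 1; ring
    rw [h1]
    have : 0 < Real.exp (-8) * Real.exp (3 / 8 * t ^ 2) := by positivity
    linarith

lemma r1_prop : (0:ℝ) < √(32 / 33) ∧ (√(32 / 33 : ℝ)) ^ 2 * (1 - 2 * (-(1 / 64))) = 1 := by
  refine ⟨by positivity, ?_⟩
  rw [Real.sq_sqrt (by norm_num)]; norm_num

lemma dom_int : Integrable (fun t : ℝ =>
    Real.exp (-(1 / 64) * t ^ 2) + Real.exp (-8) * Real.exp (3 / 8 * t ^ 2)) (gaussianReal 0 1) :=
  (gauss_int _ _ r1_prop.1 r1_prop.2).add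
    ((gauss_int (3 / 8) 2 (by norm_num) (by norm_num)).const_mul _)

lemma phi_int : Integrable (fun t => Real.exp (-(1 / 4) * phi t)) (gaussianReal 0 1) := by
  refine dom_int.mono' ?_ (ae_of_all _ fun t => ?_)
  · have := measurable_phi
    exact (by fun_prop : Measurable _).aestronglyMeasurable
  · rw [Real.norm_of_nonneg (Real.exp_pos _).le]
    exact exp_phi_le t

lemma phi_mgf : ∫ t, Real.exp (-(1 / 4) * phi t) ∂(gaussianReal 0 1) ≤ Real.exp (-(1 / 100)) := by
  have h1 := integral_mono phi_int dom_int exp_phi_le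
  refine h1.trans ?_
  rw [integral_add (gauss_int _ _ r1_prop.1 r1_prop.2)
    ((gauss_int (3 / 8) 2 (by norm_num) (by norm_num)).const_mul _), integral_const_mul,
    gauss_exp' _ _ r1_prop.1 r1_prop.2, gauss_exp' (3 / 8) 2 (by norm_num) (by norm_num)]
  have h2 : √(32 / 33 : ℝ) ≤ 0.985 := by
    rw [Real.sqrt_le_left (by norm_num)]; norm_num
  have h3 : Real.exp (-8) ≤ 1 / 400 := by
    rw [Real.exp_neg, one_div]
    apply inv_anti₀ (by norm_num)
    have e : Real.exp 8 = Real.exp 1 ^ 8 := by rw [← Real.exp_nat_mul]; norm_num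
    have : 2.7 ≤ Real.exp 1 := by have := Real.exp_one_gt_d9; linarith
    rw [e]
    calc (400:ℝ) ≤ 2.7 ^ 8 := by norm_num
      _ ≤ _ := by gcongr
  have h4 := Real.add_one_le_exp (-(1 / 100) : ℝ)
  linarith

lemma bad_prob (n : ℕ) :
    (Measure.pi fun _ : Fin (n + 1) => gaussianReal 0 1).real
      {w | ∑ i, phi (w i) ≤ (1 / 50 : ℝ) * (n + 1)} ≤ Real.exp (-(1 / 200) * n) := by
  have hprod : ∀ w : Fin (n + 1) → ℝ, Real.exp (-(1 / 4) * ∑ i, phi (w i)) =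
      ∏ i, Real.exp (-(1 / 4) * phi (w i)) := by
    intro w; rw [Finset.mul_sum, Real.exp_sum]
  have hint : Integrable (fun w : Fin (n + 1) → ℝ => Real.exp (-(1 / 4) * ∑ i, phi (w i)))
      (Measure.pi fun _ : Fin (n + 1) => gaussianReal 0 1) := by
    simp_rw [hprod]
    exact Integrable.fintype_prod (fun _ => phi_int)
  have h := measure_le_le_exp_mul_mgf (μ := Measure.pi fun _ : Fin (n + 1) => gaussianReal 0 1)
    (X := fun w : Fin (n + 1) → ℝ => ∑ i, phi (w i)) (t := -(1 / 4))
    ((1 / 50 : ℝ) * (n + 1)) (by norm_num) hint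
  refine h.trans ?_
  have hm : mgf (fun w : Fin (n + 1) → ℝ => ∑ i, phi (w i))
      (Measure.pi fun _ : Fin (n + 1) => gaussianReal 0 1) (-(1 / 4)) ≤
      Real.exp (-(1 / 100)) ^ (n + 1) := by
    unfold mgf
    simp_rw [hprod]
    rw [integral_fintype_prod_eq_prod (fun _ => fun t => Real.exp (-(1 / 4) * phi t))]
    rw [Finset.prod_const, Finset.card_univ, Fintype.card_fin]
    exact pow_le_pow_left₀ (integral_nonneg fun t => (Real.exp_pos _).le) phi_mgf _
  calc _ ≤ Real.exp (-(-(1 / 4)) * ((1 / 50 : ℝ) * (n + 1))) * Real.exp (-(1 / 100)) ^ (n + 1) := by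
        gcongr
    _ ≤ _ := by
        rw [← Real.exp_nat_mul, ← Real.exp_add]
        apply Real.exp_le_exp.mpr
        push_cast
        linarith

/-- the FEI inequality holds with probability 1 − e^{−Ω(n)} for a
random LTF with i.i.d. standard Gaussian weights. -/
theorem random_gaussian_ltf_fei :
    ∃ C c : ℝ, 0 < C ∧ 0 < c ∧ ∃ N : ℕ, ∀ n : ℕ, N ≤ n →
      (Measure.pi fun _ : Fin (n + 1) => gaussianReal 0 1)
          {w : Fin (n + 1) → ℝ | fourierEntropy (ltf n w) ≤ C * totalInfl (ltf n w)} ≥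
        ENNReal.ofReal (1 - Real.exp (-c * n)) := by
  refine ⟨2560, 1 / 200, by norm_num, by norm_num, 20000, fun n hn => ?_⟩
  have hms : MeasurableSet {w : Fin (n + 1) → ℝ | ∑ i, phi (w i) ≤ (1 / 50 : ℝ) * (n + 1)} := by
    have := measurable_phi
    exact measurableSet_le (by fun_prop) measurable_const
  have h1 := bad_prob n
  have h2 := probReal_compl_eq_one_sub (μ := Measure.pi fun _ : Fin (n + 1) => gaussianReal 0 1) hms
  have hsub : {w : Fin (n + 1) → ℝ | ∑ i, phi (w i) ≤ (1 / 50 : ℝ) * (n + 1)}ᶜ ⊆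
      {w : Fin (n + 1) → ℝ | fourierEntropy (ltf n w) ≤ 2560 * totalInfl (ltf n w)} := by
    intro w hw
    simp only [Set.mem_compl_iff, Set.mem_ofPred_eq, not_le] at hw
    exact good hn w hw.le
  refine le_trans ?_ (measure_mono hsub)
  rw [← ofReal_measureReal]
  apply ENNReal.ofReal_le_ofReal
  rw [h2]
  linarith
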